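/- For every ε > 0 there exists k₀ such that for all integers k ≥ k₀ the following holds: if F is a k-uniform intersecting family on a finite set X with covering number τ(F) = k, and x ∈ X satisfies d(x) ≥ (log k)·k^(k-2) (natural logarithm), then the number of edges of F not containing x satisfies |{f ∈ F : x ∉ f}| ≤ ε·k^(k-1). -/

import Mathlib

/-- A family of finite sets is intersecting if any two members intersect. -/
def IntersectingFamily {α : Type} [DecidableEq α] (F : Finset (Finset α)) : Prop :=
  ∀ f ∈ F, ∀ g ∈ F, (f ∩ g).Nonempty

/-- The covering number: the least size of a set meeting every member of `F`. -/
noncomputable def coverNum {α : Type} [DecidableEq α] (F : Finset (Finset α)) : ℕ :=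
  sInf {n : ℕ | ∃ C : Finset α, C.card = n ∧ ∀ f ∈ F, (f ∩ C).Nonempty}

/-- The degree of a vertex: the number of members of `F` containing it. -/
def degVert {α : Type} [DecidableEq α] (F : Finset (Finset α)) (x : α) : ℕ :=
  (F.filter fun f => x ∈ f).card

/-- The degree of a set: the number of members of `F` containing it. -/
def degSet {α : Type} [DecidableEq α] (F : Finset (Finset α)) (S : Finset α) : ℕ :=
  (F.filter fun f => S ⊆ f).card

open Finset in
/-- A set smaller than the covering number misses some member of the family. -/
theorem exists_disjoint_of_card_lt_coverNum {α : Type} [DecidableEq α] {F : Finset (Finset α)}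
    {C : Finset α} (hC : C.card < coverNum F) : ∃ f ∈ F, Disjoint f C := by
  have h := Nat.notMem_of_lt_sInf hC
  simp only [Set.mem_ofPred_eq, not_exists, not_and, not_forall] at h
  obtain ⟨f, hf, hfC⟩ := h C rfl
  exact ⟨f, hf, disjoint_iff_inter_eq_empty.2 (not_nonempty_iff_eq_empty.1 hfC)⟩

open Finset in
/-- If every member of `A` meets `g`, then some element of `g` lies in at least a `1 / |g|`
proportion of the members of `A`. -/
theorem exists_mem_card_le_card_mul_card_filter_mem {α : Type} [DecidableEq α]
    {A : Finset (Finset α)} {g : Finset α} (hg : g.Nonempty)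
    (hA : ∀ f ∈ A, (f ∩ g).Nonempty) :
    ∃ t ∈ g, A.card ≤ g.card * (A.filter fun f => t ∈ f).card := by
  by_contra! h
  have hsub : A ⊆ g.biUnion fun t => A.filter fun f => t ∈ f := fun f hf => by
    obtain ⟨t, ht⟩ := hA f hf
    rw [mem_inter] at ht
    exact mem_biUnion.2 ⟨t, ht.2, mem_filter.2 ⟨hf, ht.1⟩⟩
  have h1 : A.card ≤ ∑ t ∈ g, (A.filter fun f => t ∈ f).card :=
    (card_le_card hsub).trans card_biUnion_le
  have h2 : ∑ t ∈ g, g.card * (A.filter fun f => t ∈ f).card < ∑ _t ∈ g, A.card :=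
    sum_lt_sum_of_nonempty hg h
  rw [← mul_sum, sum_const, smul_eq_mul] at h2
  exact absurd (lt_of_mul_lt_mul_left h2 (Nat.zero_le _)) (not_lt.2 h1)

open Finset in
/-- In a `k`-uniform intersecting family with covering number `k`, a set of size `k - j` is
contained in at most `k ^ j` members. -/
theorem degSet_le_pow {α : Type} [DecidableEq α] {F : Finset (Finset α)} {k : ℕ}
    (hunif : ∀ f ∈ F, f.card = k) (hint : IntersectingFamily F) (hcov : coverNum F = k)
    (j : ℕ) (U : Finset α) (hU : U.card + j = k) : degSet F U ≤ k ^ j := by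
  induction j generalizing U with
  | zero =>
    refine card_le_one.2 fun a ha b hb => ?_
    rw [mem_filter] at ha hb
    rw [← eq_of_subset_of_card_le ha.2 (by rw [hunif a ha.1]; omega),
      ← eq_of_subset_of_card_le hb.2 (by rw [hunif b hb.1]; omega)]
  | succ j ih =>
    obtain ⟨g, hg, hgU⟩ := exists_disjoint_of_card_lt_coverNum (F := F) (C := U) (by omega)
    have hgk := hunif g hg
    obtain ⟨t, ht, hle⟩ := exists_mem_card_le_card_mul_card_filter_mem
      (A := F.filter fun f => U ⊆ f) (card_pos.1 (by omega : 0 < g.card))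
      fun f hf => hint f (mem_filter.1 hf).1 g hg
    have htU : t ∉ U := disjoint_left.1 hgU ht
    have hle' := ih (insert t U) (by rw [card_insert_of_notMem htU]; omega)
    have heq : ((F.filter fun f => U ⊆ f).filter fun f => t ∈ f)
        = F.filter fun f => insert t U ⊆ f := by
      ext f
      simp only [mem_filter, insert_subset_iff]
      tauto
    rw [heq, hgk] at hle
    calc degSet F U ≤ k * degSet F (insert t U) := hle
      _ ≤ k * k ^ j := Nat.mul_le_mul_left _ hle'
      _ = k ^ (j + 1) := by ring

open Finset in
/-- Decision-tree bound: if many edges through `x` contain `T` and miss `S`, then few edges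
avoiding `x` contain `S` and miss `T`. -/
theorem card_filter_le_multichoose_mul_pow {α : Type} [DecidableEq α] {F : Finset (Finset α)}
    {k : ℕ} (hunif : ∀ f ∈ F, f.card = k) (hint : IntersectingFamily F) (hcov : coverNum F = k)
    (x : α) (n r j : ℕ) (S T : Finset α) (hxT : x ∉ T) (hT : T.card + n + 1 = k)
    (hS : S.card + r + j = k)
    (hmass : 0 < r → (r - 1) * k ^ n <
      k * (F.filter fun f => x ∈ f ∧ T ⊆ f ∧ Disjoint f S).card) :
    (F.filter fun f => x ∉ f ∧ S ⊆ f ∧ Disjoint f T).card ≤ Nat.multichoose n r * k ^ j := by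
  induction hN : n + r generalizing n r S T with
  | zero =>
    obtain rfl : r = 0 := by omega
    obtain rfl : n = 0 := by omega
    rw [Nat.multichoose_zero_right, one_mul]
    refine le_trans (card_le_card ?_) (degSet_le_pow hunif hint hcov j S (by omega))
    exact monotone_filter_right _ fun f _ h => h.2.1
  | succ N ih =>
    rcases r with _ | r
    · rw [Nat.multichoose_zero_right, one_mul]
      refine le_trans (card_le_card ?_) (degSet_le_pow hunif hint hcov j S (by omega))
      exact monotone_filter_right _ fun f _ h => h.2.1
    have hmass := hmass (Nat.succ_pos r)
    rw [Nat.add_sub_cancel] at hmass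
    set A := F.filter fun f => x ∈ f ∧ T ⊆ f ∧ Disjoint f S with hA
    have hApos : 0 < A.card := Nat.pos_of_mul_pos_left (lt_of_le_of_lt (Nat.zero_le _) hmass)
    rcases n with _ | n
    · obtain ⟨f, hf⟩ := card_pos.1 hApos
      obtain ⟨hfF, hxf, hTf, -⟩ := mem_filter.1 hf
      have hfT : insert x T = f := eq_of_subset_of_card_le (insert_subset hxf hTf)
        (by rw [hunif f hfF, card_insert_of_notMem hxT]; omega)
      rw [Nat.multichoose_zero_succ, zero_mul, Nat.le_zero, card_eq_zero, filter_eq_empty_iff]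
      rintro g hg ⟨hxg, -, hgT⟩
      obtain ⟨y, hy⟩ := hint g hg f hfF
      rw [mem_inter, ← hfT, mem_insert] at hy
      rcases hy with ⟨hyg, rfl | hyT⟩
      · exact hxg hyg
      · exact disjoint_left.1 hgT hyg hyT
    obtain ⟨g, hg, hgT⟩ := exists_disjoint_of_card_lt_coverNum (F := F) (C := insert x T)
      (by rw [card_insert_of_notMem hxT]; omega)
    have hgk := hunif g hg
    obtain ⟨t, ht, hle⟩ := exists_mem_card_le_card_mul_card_filter_mem
      (A := A) (card_pos.1 (by omega : 0 < g.card))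
      fun f hf => hint f (mem_filter.1 hf).1 g hg
    rw [hgk] at hle
    have htxT : t ∉ insert x T := disjoint_left.1 hgT ht
    have htT : t ∉ T := fun h => htxT (mem_insert_of_mem h)
    have htx : x ≠ t := fun h => htxT (h ▸ mem_insert_self x T)
    have hyes : (A.filter fun f => t ∈ f)
        = F.filter fun f => x ∈ f ∧ insert t T ⊆ f ∧ Disjoint f S := by
      ext f
      simp only [hA, mem_filter, insert_subset_iff]
      tauto
    have hno : (A.filter fun f => t ∉ f)
        = F.filter fun f => x ∈ f ∧ T ⊆ f ∧ Disjoint f (insert t S) := by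
      ext f
      simp only [hA, mem_filter, disjoint_insert_right]
      tauto
    have hsplit := card_filter_add_card_filter_not (s := A) (fun f => t ∈ f)
    have htS : t ∉ S := fun h => by
      have h0 : (A.filter fun f => t ∈ f).card = 0 := by
        rw [card_eq_zero, filter_eq_empty_iff]
        exact fun f hf htf => disjoint_left.1 (mem_filter.1 hf).2.2.2 htf h
      rw [h0] at hle
      omega
    have hdeg : (A.filter fun f => t ∈ f).card ≤ k ^ n := by
      refine le_trans (card_le_card ?_)
        (degSet_le_pow hunif hint hcov n (insert x (insert t T)) ?_)
      · rw [hyes]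
        exact monotone_filter_right _ fun f _ h => insert_subset h.1 h.2.1
      · rw [card_insert_of_notMem (by simp [htx, hxT]), card_insert_of_notMem htT]
        omega
    have hin := ih (n + 1) r (insert t S) T hxT hT
      (by rw [card_insert_of_notMem htS]; omega)
      (fun hr => by
        rw [← hno]
        obtain ⟨q, rfl⟩ : ∃ q, r = q + 1 := ⟨r - 1, by omega⟩
        have h1 : k * (A.filter fun f => t ∈ f).card ≤ k ^ (n + 1) := by
          rw [pow_succ']
          exact Nat.mul_le_mul_left _ hdeg
        rw [← hsplit] at hmass
        rw [Nat.add_sub_cancel]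
        nlinarith) (by omega)
    have hout := ih n (r + 1) S (insert t T) (by simp [htx, hxT])
      (by rw [card_insert_of_notMem htT]; omega) hS
      (fun _ => by
        rw [← hyes, Nat.add_sub_cancel]
        have h2 : k * (r * k ^ n) < k * (k * (A.filter fun f => t ∈ f).card) :=
          calc k * (r * k ^ n) = r * k ^ (n + 1) := by ring
            _ < k * A.card := hmass
            _ ≤ _ := Nat.mul_le_mul_left _ hle
        exact lt_of_mul_lt_mul_left h2 (Nat.zero_le _)) (by omega)
    rw [Nat.multichoose_succ_succ, add_mul, add_comm,
      ← card_filter_add_card_filter_not (fun f => t ∈ f)]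
    refine add_le_add (le_trans (card_le_card fun f hf => ?_) hin)
      (le_trans (card_le_card fun f hf => ?_) hout)
    · simp only [mem_filter, insert_subset_iff] at hf ⊢
      tauto
    · simp only [mem_filter, disjoint_insert_right] at hf ⊢
      tauto

theorem multichoose_mul_factorial_le_pow (n r : ℕ) :
    Nat.multichoose n r * r.factorial ≤ (n + r) ^ r := by
  rw [Nat.multichoose_eq, mul_comm, ← Nat.descFactorial_eq_factorial_mul_choose]
  exact (Nat.descFactorial_le_pow _ _).trans (Nat.pow_le_pow_left (Nat.sub_le _ _) _)

/-- if `d(x) ≥ (log k)·k^(k-2)` then few edges avoid `x`. -/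
theorem few_edges_avoid_high_degree_vertex :
    ∀ ε : ℝ, 0 < ε → ∃ k₀ : ℕ, ∀ k : ℕ, k₀ ≤ k →
      ∀ (α : Type) [DecidableEq α] (X : Finset α) (F : Finset (Finset α)),
        (∀ f ∈ F, f ⊆ X) → (∀ f ∈ F, f.card = k) → IntersectingFamily F →
        coverNum F = k →
        ∀ x ∈ X, Real.log k * (k : ℝ) ^ (k - 2) ≤ (degVert F x : ℝ) →
        ((F.filter fun f => x ∉ f).card : ℝ) ≤ ε * (k : ℝ) ^ (k - 1) := by
  intro ε hε
  have hm : Filter.Tendsto (fun k : ℕ => ⌈Real.log k⌉₊) Filter.atTop Filter.atTop :=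
    tendsto_nat_ceil_atTop.comp (Real.tendsto_log_atTop.comp tendsto_natCast_atTop_atTop)
  have hev := (hm.eventually ((FloorSemiring.tendsto_pow_div_factorial_atTop
    (2 * Real.exp 1)).eventually (gt_mem_nhds hε))).and (Filter.eventually_ge_atTop 2)
  obtain ⟨k₀, hk₀⟩ := Filter.eventually_atTop.1 hev
  refine ⟨k₀, fun k hk α _ X F _ hunif hint hcov x _ hdeg => ?_⟩
  obtain ⟨hsmall, hk2⟩ := hk₀ k hk
  set m := ⌈Real.log k⌉₊ with hmdef
  have hkR : (2 : ℝ) ≤ k := by exact_mod_cast hk2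
  have hlogpos : 0 < Real.log k := Real.log_pos (by linarith)
  have hmpos : 0 < m := Nat.ceil_pos.2 hlogpos
  have hmk : m ≤ k := Nat.ceil_le.2 (Real.log_le_self (by linarith))
  have hmlt : ((m - 1 : ℕ) : ℝ) < Real.log k := Nat.lt_ceil.1 (by omega)
  have hkexp : (k : ℝ) ≤ Real.exp 1 ^ m := by
    rw [← Real.exp_nat_mul, mul_one, ← Real.log_le_iff_le_exp (by linarith)]
    exact Nat.le_ceil _
  have hmass : (m - 1) * k ^ (k - 1) < k * degVert F x := by
    have hpow : (k : ℝ) ^ (k - 1) = k * (k : ℝ) ^ (k - 2) := by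
      rw [← pow_succ']
      congr 1
      omega
    have : ((m - 1 : ℕ) : ℝ) * (k : ℝ) ^ (k - 1) < k * (degVert F x : ℝ) :=
      calc ((m - 1 : ℕ) : ℝ) * (k : ℝ) ^ (k - 1)
          < Real.log k * (k : ℝ) ^ (k - 1) := by gcongr
        _ = k * (Real.log k * (k : ℝ) ^ (k - 2)) := by rw [hpow]; ring
        _ ≤ _ := by gcongr
    exact_mod_cast this
  have hcount := card_filter_le_multichoose_mul_pow hunif hint hcov x (k - 1) m (k - m) ∅ ∅
    (by simp) (by rw [Finset.card_empty]; omega) (by rw [Finset.card_empty]; omega)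
    (fun _ => by simpa [degVert] using hmass)
  simp only [Finset.empty_subset, Finset.disjoint_empty_right, and_true] at hcount
  have hmc : Nat.multichoose (k - 1) m * m.factorial ≤ (2 * k) ^ m :=
    (multichoose_mul_factorial_le_pow _ _).trans (Nat.pow_le_pow_left (by omega) _)
  have hfac : (0 : ℝ) < m.factorial := by exact_mod_cast m.factorial_pos
  have hmcR : (Nat.multichoose (k - 1) m : ℝ) ≤ (2 * k) ^ m / m.factorial := by
    rw [le_div_iff₀ hfac]
    exact_mod_cast hmc
  have hkk : (k : ℝ) ^ m * (k : ℝ) ^ (k - m) = k * (k : ℝ) ^ (k - 1) := by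
    rw [← pow_add, ← pow_succ']
    congr 1
    omega
  calc ((F.filter fun f => x ∉ f).card : ℝ)
      ≤ Nat.multichoose (k - 1) m * (k : ℝ) ^ (k - m) := by exact_mod_cast hcount
    _ ≤ (2 * k) ^ m / m.factorial * (k : ℝ) ^ (k - m) := by gcongr
    _ = 2 ^ m / m.factorial * ((k : ℝ) ^ m * (k : ℝ) ^ (k - m)) := by rw [mul_pow]; ring
    _ = 2 ^ m * k / m.factorial * (k : ℝ) ^ (k - 1) := by rw [hkk]; ring
    _ ≤ 2 ^ m * Real.exp 1 ^ m / m.factorial * (k : ℝ) ^ (k - 1) := by gcongr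
    _ = (2 * Real.exp 1) ^ m / m.factorial * (k : ℝ) ^ (k - 1) := by rw [mul_pow]
    _ ≤ ε * (k : ℝ) ^ (k - 1) := by gcongr
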